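/- arXiv:1303.6319 — 10 statements merged into one kernel-verified Lean document; each statement's English description precedes it below -/
import Mathlib

section
/- For every integer k ≥ 1, the sums s_k satisfy the recurrence s_{k+1} − 2 s_k + s_{k−1} = 2 s_1 − s̄_k. -/
/-- The sum `s_k = 2^{-α} ∑_{j=1}^{n-1} sin²(k j π/n) / sin^{α+1}(j π/n)`
(with `ζ = 2π/n`, so that `j ζ/2 = j π/n`). -/
noncomputable def sSum (n : ℕ) (α : ℝ) (k : ℤ) : ℝ :=
  (2 : ℝ) ^ (-α) * ∑ j ∈ Finset.Ico 1 n,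
    Real.sin ((k : ℝ) * j * Real.pi / n) ^ 2 / Real.sin ((j : ℝ) * Real.pi / n) ^ (α + 1)

/-- The sum `s̄_k = 2^{2-α} ∑_{j=1}^{n-1} sin²(k j π/n) / sin^{α-1}(j π/n)`. -/
noncomputable def sBar (n : ℕ) (α : ℝ) (k : ℤ) : ℝ :=
  (2 : ℝ) ^ (2 - α) * ∑ j ∈ Finset.Ico 1 n,
    Real.sin ((k : ℝ) * j * Real.pi / n) ^ 2 / Real.sin ((j : ℝ) * Real.pi / n) ^ (α - 1)

/-- The second difference in `k` of `sin² (k x)`. -/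
theorem sin_sq_second_difference (a x : ℝ) :
    Real.sin (a + x) ^ 2 - 2 * Real.sin a ^ 2 + Real.sin (a - x) ^ 2
      = 2 * Real.sin x ^ 2 - 4 * (Real.sin a ^ 2 * Real.sin x ^ 2) := by
  rw [Real.sin_add, Real.sin_sub]
  linear_combination 2 * Real.sin a ^ 2 * Real.sin_sq_add_cos_sq x
    + 2 * Real.sin x ^ 2 * Real.sin_sq_add_cos_sq a

/-- **Recurrence formula.** For every integer `k ≥ 1`,
`s_{k+1} − 2 s_k + s_{k−1} = 2 s_1 − s̄_k`. -/
theorem sSum_recurrence (n : ℕ) (hn : 2 ≤ n) (α : ℝ) (hα : 1 ≤ α) (k : ℤ) (hk : 1 ≤ k) :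
    sSum n α (k + 1) - 2 * sSum n α k + sSum n α (k - 1)
      = 2 * sSum n α 1 - sBar n α k := by
  have h4 : (2 : ℝ) ^ (2 - α) = 2 ^ (-α) * 4 := by
    rw [show 2 - α = -α + 2 by ring, Real.rpow_add two_pos]
    norm_num
  simp only [sSum, sBar, h4, mul_left_comm (2 : ℝ) ((2 : ℝ) ^ (-α)), mul_assoc ((2 : ℝ) ^ (-α))]
  rw [← mul_sub, ← mul_add, ← mul_sub]
  congr 1
  simp only [Finset.mul_sum]
  rw [← Finset.sum_sub_distrib, ← Finset.sum_add_distrib, ← Finset.sum_sub_distrib]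
  refine Finset.sum_congr rfl fun j hj => ?_
  obtain ⟨hj1, hjn⟩ := Finset.mem_Ico.mp hj
  have hn0 : (0 : ℝ) < n := by exact_mod_cast (by omega : 0 < n)
  have hj0 : (0 : ℝ) < j := by exact_mod_cast hj1
  have hjn' : (j : ℝ) < n := by exact_mod_cast hjn
  have hsin : 0 < Real.sin (j * Real.pi / n) := by
    refine Real.sin_pos_of_pos_of_lt_pi (by positivity) ?_
    rw [div_lt_iff₀ hn0, mul_comm]
    exact mul_lt_mul_of_pos_left hjn' Real.pi_pos
  have hpow : Real.sin (j * Real.pi / n) ^ (α + 1)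
      = Real.sin (j * Real.pi / n) ^ (α - 1) * Real.sin (j * Real.pi / n) ^ 2 := by
    rw [show α + 1 = α - 1 + 2 by ring, Real.rpow_add hsin, Real.rpow_two]
  have hp : 0 < Real.sin (j * Real.pi / n) ^ (α - 1) := Real.rpow_pos_of_pos hsin _
  have key := sin_sq_second_difference (k * j * Real.pi / n) (j * Real.pi / n)
  push_cast
  rw [show ((k : ℝ) + 1) * j * Real.pi / n = k * j * Real.pi / n + j * Real.pi / n by ring,
    show ((k : ℝ) - 1) * j * Real.pi / n = k * j * Real.pi / n - j * Real.pi / n by ring,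
    one_mul, hpow]
  generalize Real.sin (k * j * Real.pi / n + j * Real.pi / n) = u at key ⊢
  generalize Real.sin (k * j * Real.pi / n - j * Real.pi / n) = v at key ⊢
  generalize Real.sin (k * j * Real.pi / n) = w at key ⊢
  field_simp
  linear_combination key
end

section
/- For every integer k ≥ 0, the sums s_k satisfy s_{k+1} − s_k = (2k+1) s_1 − ∑_{l=1}^{k} s̄_l. -/
/-- The second difference of `sin²`. -/
theorem sin_add_sq_add_sin_sub_sq (x y : ℝ) :
    Real.sin (x + y) ^ 2 + Real.sin (x - y) ^ 2
      = 2 * Real.sin x ^ 2 + 2 * Real.sin y ^ 2 - 4 * (Real.sin x ^ 2 * Real.sin y ^ 2) := by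
  rw [Real.sin_add, Real.sin_sub]
  linear_combination 2 * Real.sin x ^ 2 * Real.sin_sq_add_cos_sq y +
    2 * Real.sin y ^ 2 * Real.sin_sq_add_cos_sq x

theorem sSum_zero (n : ℕ) (α : ℝ) : sSum n α 0 = 0 := by
  simp [sSum]

/-- The second difference of `sSum`. -/
theorem sSum_add_one_add_sSum_sub_one (n : ℕ) (α : ℝ) (k : ℤ) :
    sSum n α (k + 1) + sSum n α (k - 1) = 2 * sSum n α k + 2 * sSum n α 1 - sBar n α k := by
  have h_two : (2 : ℝ) ^ (2 - α) = 4 * 2 ^ (-α) := by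
    rw [sub_eq_add_neg, Real.rpow_add two_pos]
    norm_num
  simp only [sSum, sBar, h_two, Finset.mul_sum, ← Finset.sum_add_distrib,
    ← Finset.sum_sub_distrib]
  refine Finset.sum_congr rfl fun j hj => ?_
  obtain ⟨hj1, hjn⟩ := Finset.mem_Ico.mp hj
  have hj0 : (0 : ℝ) < j := by exact_mod_cast hj1
  have hjn' : (j : ℝ) < n := by exact_mod_cast hjn
  have hn0 : (0 : ℝ) < n := hj0.trans hjn'
  have h_sin : 0 < Real.sin ((j : ℝ) * Real.pi / n) := by
    apply Real.sin_pos_of_pos_of_lt_pi (by positivity)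
    rw [div_lt_iff₀ hn0, mul_comm]
    exact mul_lt_mul_of_pos_left hjn' Real.pi_pos
  have h_pow : Real.sin ((j : ℝ) * Real.pi / n) ^ (α + 1)
      = Real.sin ((j : ℝ) * Real.pi / n) ^ (α - 1) * Real.sin ((j : ℝ) * Real.pi / n) ^ 2 := by
    rw [← Real.rpow_natCast, ← Real.rpow_add h_sin]
    congr 1
    push_cast
    ring
  have h_pos := Real.rpow_pos_of_pos h_sin (α - 1)
  have h_diff := sin_add_sq_add_sin_sub_sq ((k : ℝ) * j * Real.pi / n) ((j : ℝ) * Real.pi / n)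
  have h_add : ((k + 1 : ℤ) : ℝ) * j * Real.pi / n
      = (k : ℝ) * j * Real.pi / n + (j : ℝ) * Real.pi / n := by
    push_cast
    ring
  have h_sub : ((k - 1 : ℤ) : ℝ) * j * Real.pi / n
      = (k : ℝ) * j * Real.pi / n - (j : ℝ) * Real.pi / n := by
    push_cast
    ring
  rw [h_add, h_sub, h_pow, Int.cast_one, one_mul]
  generalize Real.sin ((j : ℝ) * Real.pi / n) ^ (α - 1) = p at *
  generalize (2 : ℝ) ^ (-α) = c
  generalize (j : ℝ) * Real.pi / n = y at *
  generalize (k : ℝ) * j * Real.pi / n = x at *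
  field_simp
  linear_combination c * h_diff

/-- **Recurrence formula.** For every integer `k ≥ 0`,
`s_{k+1} − s_k = (2k+1) s_1 − ∑_{l=1}^{k} s̄_l`. -/
theorem sSum_succ_sub (n : ℕ) (hn : 2 ≤ n) (α : ℝ) (hα : 1 ≤ α) (k : ℤ) (hk : 0 ≤ k) :
    sSum n α (k + 1) - sSum n α k
      = (2 * (k : ℝ) + 1) * sSum n α 1 - ∑ l ∈ Finset.Icc 1 k, sBar n α l := by
  induction k, hk using Int.leInduction with
  | base => simp [sSum_zero]
  | succ k hk ih =>
    have h_Icc : Finset.Icc 1 (k + 1) = insert (k + 1) (Finset.Icc 1 k) := by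
      ext l
      simp only [Finset.mem_Icc, Finset.mem_insert]
      omega
    have h_rec := sSum_add_one_add_sSum_sub_one n α (k + 1)
    rw [add_sub_cancel_right] at h_rec
    rw [h_Icc, Finset.sum_insert (by simp)]
    push_cast
    linear_combination h_rec + ih
end

section
/- For every integer n ≥ 3 and every integer k with 1 ≤ k ≤ n−1, one has the strict inequalities s_{k+1} − 2 s_k + s_{k−1} < 2 s_1 and s_{k+1} + 2 s_k + s_{k−1} > 2 s_1. -/
theorem sin_succ_mul_sq_sub_two_mul_add_sin_pred_mul_sq (κ x : ℝ) :
    Real.sin ((κ + 1) * x) ^ 2 - 2 * Real.sin (κ * x) ^ 2 + Real.sin ((κ - 1) * x) ^ 2 =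
      2 * Real.sin x ^ 2 - 4 * (Real.sin x ^ 2 * Real.sin (κ * x) ^ 2) := by
  rw [add_mul, sub_mul, one_mul, Real.sin_add, Real.sin_sub]
  linear_combination 2 * Real.sin x ^ 2 * Real.sin_sq_add_cos_sq (κ * x) +
    2 * Real.sin (κ * x) ^ 2 * Real.sin_sq_add_cos_sq x

/-- The second difference of `sSum`, with `s̄_k` written in terms of the weights of `sSum`. -/
theorem sSum_second_difference (n : ℕ) (α : ℝ) (k : ℤ) :
    sSum n α (k + 1) - 2 * sSum n α k + sSum n α (k - 1) = 2 * sSum n α 1 -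
      4 * ((2 : ℝ) ^ (-α) * ∑ j ∈ Finset.Ico 1 n,
        Real.sin ((j : ℝ) * Real.pi / n) ^ 2 * Real.sin ((k : ℝ) * j * Real.pi / n) ^ 2 /
          Real.sin ((j : ℝ) * Real.pi / n) ^ (α + 1)) := by
  simp only [sSum, Finset.mul_sum, ← Finset.sum_sub_distrib, ← Finset.sum_add_distrib]
  refine Finset.sum_congr rfl fun j _ => ?_
  have h := sin_succ_mul_sq_sub_two_mul_add_sin_pred_mul_sq k ((j : ℝ) * Real.pi / n)
  have e (c : ℝ) : c * j * Real.pi / n = c * (j * Real.pi / n) := by ring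
  push_cast
  simp only [e, one_mul]
  linear_combination
    (2 : ℝ) ^ (-α) / Real.sin ((j : ℝ) * Real.pi / n) ^ (α + 1) * h

theorem sin_natCast_mul_pi_div_pos {n j : ℕ} (hj : j ∈ Finset.Ico 1 n) :
    0 < Real.sin ((j : ℝ) * Real.pi / n) := by
  obtain ⟨h1, h2⟩ := Finset.mem_Ico.mp hj
  have hn : (0 : ℝ) < n := by exact_mod_cast (by omega : 0 < n)
  have hj0 : (0 : ℝ) < j := by exact_mod_cast h1
  have hjn : (j : ℝ) < n := by exact_mod_cast h2
  refine Real.sin_pos_of_pos_of_lt_pi (by positivity) ?_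
  rw [div_lt_iff₀ hn, mul_comm]
  exact mul_lt_mul_of_pos_left hjn Real.pi_pos

/-- **Corollary of the recurrence formula.** For `n ≥ 3` and `1 ≤ k ≤ n−1`, one has the strict
inequalities `s_{k+1} − 2 s_k + s_{k−1} < 2 s_1` and `s_{k+1} + 2 s_k + s_{k−1} > 2 s_1`. -/
theorem sSum_inequalities (n : ℕ) (hn : 3 ≤ n) (α : ℝ) (hα : 1 ≤ α)
    (k : ℤ) (hk1 : 1 ≤ k) (hk2 : k ≤ (n : ℤ) - 1) :
    sSum n α (k + 1) - 2 * sSum n α k + sSum n α (k - 1) < 2 * sSum n α 1 ∧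
    sSum n α (k + 1) + 2 * sSum n α k + sSum n α (k - 1) > 2 * sSum n α 1 := by
  have hrec := sSum_second_difference n α k
  have h1n : 1 ∈ Finset.Ico 1 n := Finset.mem_Ico.mpr ⟨le_rfl, by omega⟩
  have hw : ∀ j ∈ Finset.Ico 1 n, 0 < Real.sin ((j : ℝ) * Real.pi / n) ^ (α + 1) :=
    fun j hj => Real.rpow_pos_of_pos (sin_natCast_mul_pi_div_pos hj) _
  have hs1 := sin_natCast_mul_pi_div_pos h1n
  have hsk : 0 < Real.sin ((k : ℝ) * (1 : ℕ) * Real.pi / n) := by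
    lift k to ℕ using by omega
    simpa using sin_natCast_mul_pi_div_pos (n := n) (j := k) (Finset.mem_Ico.mpr (by omega))
  have hs1_lt : Real.sin (((1 : ℕ) : ℝ) * Real.pi / n) ^ 2 < 1 := by
    have hn0 : (3 : ℝ) ≤ n := by exact_mod_cast hn
    have hcos : 0 < Real.cos (((1 : ℕ) : ℝ) * Real.pi / n) := by
      refine Real.cos_pos_of_mem_Ioo ⟨?_, ?_⟩
      · have : 0 < ((1 : ℕ) : ℝ) * Real.pi / n := by positivity
        linarith [Real.pi_pos]
      · rw [Nat.cast_one, one_mul]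
        exact div_lt_div_of_pos_left Real.pi_pos two_pos (by linarith)
    nlinarith [Real.sin_sq_add_cos_sq (((1 : ℕ) : ℝ) * Real.pi / n)]
  have hc : (0 : ℝ) < 2 ^ (-α) := by positivity
  constructor
  · have hsum : 0 < ∑ j ∈ Finset.Ico 1 n,
        Real.sin ((j : ℝ) * Real.pi / n) ^ 2 * Real.sin ((k : ℝ) * j * Real.pi / n) ^ 2 /
          Real.sin ((j : ℝ) * Real.pi / n) ^ (α + 1) := by
      refine Finset.sum_pos' (fun j hj => ?_) ⟨1, h1n, ?_⟩
      · have := hw j hj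
        positivity
      · exact div_pos (mul_pos (pow_pos hs1 2) (pow_pos hsk 2)) (hw 1 h1n)
    linarith [mul_pos hc hsum]
  · have hsum : ∑ j ∈ Finset.Ico 1 n,
        Real.sin ((j : ℝ) * Real.pi / n) ^ 2 * Real.sin ((k : ℝ) * j * Real.pi / n) ^ 2 /
          Real.sin ((j : ℝ) * Real.pi / n) ^ (α + 1) <
        ∑ j ∈ Finset.Ico 1 n, Real.sin ((k : ℝ) * j * Real.pi / n) ^ 2 /
          Real.sin ((j : ℝ) * Real.pi / n) ^ (α + 1) := by
      refine Finset.sum_lt_sum (fun j hj => ?_) ⟨1, h1n, ?_⟩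
      · exact div_le_div_of_nonneg_right
          (mul_le_of_le_one_left (sq_nonneg _) (Real.sin_sq_le_one _)) (hw j hj).le
      · exact div_lt_div_of_pos_right
          (mul_lt_of_lt_one_left (pow_pos hsk 2) hs1_lt) (hw 1 h1n)
    have hlt := mul_lt_mul_of_pos_left hsum hc
    change _ < sSum n α k at hlt
    linarith
end

section
/- For the Newtonian exponent α = 2, the sums s_k are strictly increasing on {0, 1, ..., ⌊n/2⌋}: for every integer k with 1 ≤ k ≤ ⌊n/2⌋ one has s_k > s_{k−1}. -/
/-- The sum `s_k = (1/4) ∑_{j=1}^{n-1} sin²(k j π/n) / sin³(j π/n)`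
(Newtonian exponent `α = 2`). -/
noncomputable def sN (n k : ℕ) : ℝ :=
  (1 / 4) * ∑ j ∈ Finset.Ico 1 n,
    Real.sin ((k : ℝ) * j * Real.pi / n) ^ 2 / Real.sin ((j : ℝ) * Real.pi / n) ^ 3

/-- Telescoped form of `∑_{j=1}^{n-1} sin (j φ)`. -/
theorem sum_sin_mul_two_sin_half (φ : ℝ) (n : ℕ) (hn : 1 ≤ n) :
    (∑ j ∈ Finset.Ico 1 n, Real.sin (j * φ)) * (2 * Real.sin (φ / 2)) =
      Real.cos (φ / 2) - Real.cos (n * φ - φ / 2) := by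
  induction n, hn using Nat.le_induction with
  | base => simp [show φ - φ / 2 = φ / 2 by ring]
  | succ m hm ih =>
    rw [Finset.sum_Ico_succ_top hm, add_mul, ih]
    push_cast
    rw [show ((m : ℝ) + 1) * φ - φ / 2 = m * φ + φ / 2 by ring, Real.cos_sub, Real.cos_add]
    ring

theorem sum_sin_odd_nonneg (n k : ℕ) (hk : 2 * k + 1 ≤ n) :
    0 ≤ ∑ j ∈ Finset.Ico 1 n, Real.sin ((2 * k + 1) * (j * Real.pi / n)) := by
  have hn : (0 : ℝ) < n := by exact_mod_cast (show 0 < n by omega)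
  have hk' : (2 * k + 1 : ℝ) ≤ n := by exact_mod_cast hk
  have hpi := Real.pi_pos
  set φ : ℝ := (2 * k + 1) * Real.pi / n with hφ
  have hφ0 : 0 < φ := by positivity
  have hφ1 : φ ≤ Real.pi := by
    rw [hφ, div_le_iff₀ hn, mul_comm Real.pi]
    gcongr
  have hsum : ∑ j ∈ Finset.Ico 1 n, Real.sin ((2 * k + 1) * (j * Real.pi / n)) =
      ∑ j ∈ Finset.Ico 1 n, Real.sin (j * φ) :=
    Finset.sum_congr rfl fun j _ => by rw [hφ]; congr 1; ring
  have hend : Real.cos (n * φ - φ / 2) = -Real.cos (φ / 2) := by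
    rw [show n * φ - φ / 2 = Real.pi - φ / 2 + k * (2 * Real.pi) by rw [hφ]; field_simp; ring,
      Real.cos_add_nat_mul_two_pi, Real.cos_pi_sub]
  have hsin : 0 < Real.sin (φ / 2) := Real.sin_pos_of_pos_of_lt_pi (by linarith) (by linarith)
  have hcos : 0 ≤ Real.cos (φ / 2) := Real.cos_nonneg_of_mem_Icc ⟨by linarith, by linarith⟩
  have h := sum_sin_mul_two_sin_half φ n (by omega)
  rw [hend] at h
  rw [hsum]
  exact nonneg_of_mul_nonneg_left (h ▸ by linarith) (by linarith : 0 < 2 * Real.sin (φ / 2))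

theorem sin_mul_pi_div_pos {n j : ℕ} (hj : j ∈ Finset.Ico 1 n) :
    0 < Real.sin (j * Real.pi / n) := by
  obtain ⟨h1, h2⟩ := Finset.mem_Ico.mp hj
  have hn : (0 : ℝ) < n := by exact_mod_cast (show 0 < n by omega)
  have hj0 : (0 : ℝ) < j := by exact_mod_cast h1
  have hjn : (j : ℝ) < n := by exact_mod_cast h2
  have hpi := Real.pi_pos
  refine Real.sin_pos_of_pos_of_lt_pi (by positivity) ?_
  rw [div_lt_iff₀ hn, mul_comm Real.pi]
  gcongr

/-- Four times the first difference of `sN n`. -/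
noncomputable def sinSum (n k : ℕ) : ℝ :=
  ∑ j ∈ Finset.Ico 1 n,
    Real.sin ((2 * k + 1) * (j * Real.pi / n)) / Real.sin (j * Real.pi / n) ^ 2

/-- Half the first difference of `sinSum n`. -/
noncomputable def cosSum (n k : ℕ) : ℝ :=
  ∑ j ∈ Finset.Ico 1 n, Real.cos (2 * k * (j * Real.pi / n)) / Real.sin (j * Real.pi / n)

theorem sN_succ_sub (n k : ℕ) : sN n (k + 1) - sN n k = 1 / 4 * sinSum n k := by
  rw [sN, sN, sinSum, ← mul_sub, ← Finset.sum_sub_distrib]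
  congr 1
  refine Finset.sum_congr rfl fun j hj => ?_
  have hs := (sin_mul_pi_div_pos hj).ne'
  push_cast
  set θ : ℝ := j * Real.pi / n with hθ
  rw [show ((k : ℝ) + 1) * j * Real.pi / n = k * θ + θ by rw [hθ]; ring,
    show (k : ℝ) * j * Real.pi / n = k * θ by rw [hθ]; ring,
    show (2 * (k : ℝ) + 1) * θ = k * θ + (k * θ + θ) by ring,
    Real.sin_add (k * θ) (k * θ + θ), Real.sin_add, Real.cos_add]
  field_simp
  linear_combination (Real.sin (k * θ)) ^ 2 * Real.sin_sq_add_cos_sq θ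

theorem sinSum_succ (n k : ℕ) : sinSum n (k + 1) = sinSum n k + 2 * cosSum n (k + 1) := by
  rw [sinSum, sinSum, cosSum, Finset.mul_sum, ← Finset.sum_add_distrib]
  refine Finset.sum_congr rfl fun j hj => ?_
  have hs := (sin_mul_pi_div_pos hj).ne'
  push_cast
  set θ : ℝ := j * Real.pi / n
  rw [show (2 * ((k : ℝ) + 1) + 1) * θ = 2 * (k + 1) * θ + θ by ring,
    show (2 * (k : ℝ) + 1) * θ = 2 * (k + 1) * θ - θ by ring, Real.sin_add, Real.sin_sub]
  field_simp
  ring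

theorem cosSum_succ_le (n k : ℕ) (hk : 2 * k + 1 ≤ n) : cosSum n (k + 1) ≤ cosSum n k := by
  have h : cosSum n (k + 1) = cosSum n k -
      2 * ∑ j ∈ Finset.Ico 1 n, Real.sin ((2 * k + 1) * (j * Real.pi / n)) := by
    rw [cosSum, cosSum, Finset.mul_sum, ← Finset.sum_sub_distrib]
    refine Finset.sum_congr rfl fun j hj => ?_
    have hs := (sin_mul_pi_div_pos hj).ne'
    push_cast
    set θ : ℝ := j * Real.pi / n
    rw [show 2 * ((k : ℝ) + 1) * θ = (2 * k + 1) * θ + θ by ring,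
      show 2 * (k : ℝ) * θ = (2 * k + 1) * θ - θ by ring, Real.cos_add, Real.cos_sub]
    field_simp
    ring
  linarith [sum_sin_odd_nonneg n k hk]

theorem sinSum_reflect (n a b : ℕ) (h : a + b + 1 = n) : sinSum n a = -sinSum n b := by
  have hn : (n : ℝ) ≠ 0 := by exact_mod_cast (show n ≠ 0 by omega)
  have ha : (a : ℝ) = n - 1 - b := by rw [← h]; push_cast; ring
  rw [sinSum, sinSum, ← Finset.sum_neg_distrib]
  refine Finset.sum_congr rfl fun j _ => ?_
  rw [show (2 * (a : ℝ) + 1) * (j * Real.pi / n) =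
      j * (2 * Real.pi) - (2 * b + 1) * (j * Real.pi / n) by rw [ha]; field_simp; ring,
    Real.sin_nat_mul_two_pi_sub, neg_div]

theorem cosSum_reflect (n a b : ℕ) (hn : n ≠ 0) (h : a + b = n) : cosSum n a = cosSum n b := by
  have hn : (n : ℝ) ≠ 0 := by exact_mod_cast hn
  have ha : (a : ℝ) = n - b := by rw [← h]; push_cast; ring
  rw [cosSum, cosSum]
  refine Finset.sum_congr rfl fun j _ => ?_
  rw [show 2 * (a : ℝ) * (j * Real.pi / n) =
      j * (2 * Real.pi) - 2 * b * (j * Real.pi / n) by rw [ha]; field_simp,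
    Real.cos_nat_mul_two_pi_sub]

theorem sinSum_zero_pos (n : ℕ) (hn : 2 ≤ n) : 0 < sinSum n 0 := by
  refine Finset.sum_pos (fun j hj => ?_) ⟨1, Finset.mem_Ico.mpr ⟨le_rfl, hn⟩⟩
  have hs := sin_mul_pi_div_pos hj
  simp only [Nat.cast_zero, mul_zero, zero_add, one_mul]
  positivity

theorem cosSum_le_of_le (n i j : ℕ) (hij : i ≤ j) (hj : 2 * j ≤ n) :
    cosSum n j ≤ cosSum n i := by
  induction j, hij using Nat.le_induction with
  | base => exact le_rfl
  | succ m _ ih => exact (cosSum_succ_le n m (by omega)).trans (ih (by omega))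

theorem sinSum_pos (n k : ℕ) (hk : 2 * (k + 1) ≤ n) : 0 < sinSum n k := by
  by_cases hC : ∀ i, 1 ≤ i → i ≤ k → 0 ≤ cosSum n i
  · have hmono : ∀ m ≤ k, 0 < sinSum n m := by
      intro m
      induction m with
      | zero => exact fun _ => sinSum_zero_pos n (by omega)
      | succ m ih =>
        intro hm
        rw [sinSum_succ]
        linarith [ih (by omega), hC (m + 1) (by omega) hm]
    exact hmono k le_rfl
  · push Not at hC
    obtain ⟨i, -, hik, hi⟩ := hC
    have hneg : ∀ j, i ≤ j → i + j ≤ n → cosSum n j < 0 := by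
      intro j hij hjn
      rcases le_total (2 * j) n with h | h
      · exact (cosSum_le_of_le n i j hij h).trans_lt hi
      · rw [cosSum_reflect n j (n - j) (by omega) (by omega)]
        exact (cosSum_le_of_le n i (n - j) (by omega) (by omega)).trans_lt hi
    have hdecr : ∀ m, k + 1 ≤ m → m + k + 1 ≤ n → sinSum n m < sinSum n k := by
      intro m hm
      induction m, hm using Nat.le_induction with
      | base =>
        intro h
        rw [sinSum_succ]
        linarith [hneg (k + 1) (by omega) (by omega)]
      | succ m hm ih =>
        intro h
        rw [sinSum_succ]
        linarith [hneg (m + 1) (by omega) (by omega), ih (by omega)]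
    have h := hdecr (n - 1 - k) (by omega) (by omega)
    rw [sinSum_reflect n (n - 1 - k) k (by omega)] at h
    linarith

/-- **Monotonicity of the sums `s_k`.** For the Newtonian exponent `α = 2`, the sums `s_k` are
strictly increasing on `{0, 1, ..., ⌊n/2⌋}`: for every `1 ≤ k ≤ ⌊n/2⌋`, `s_k > s_{k−1}`. -/
theorem sN_strict_mono (n : ℕ) (hn : 2 ≤ n) (k : ℕ) (hk1 : 1 ≤ k) (hk2 : k ≤ n / 2) :
    sN n (k - 1) < sN n k := by
  obtain ⟨m, rfl⟩ := Nat.exists_eq_add_of_le' hk1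
  rw [Nat.add_sub_cancel]
  linarith [sN_succ_sub n m, sinSum_pos n m (by omega)]
end

section
/- For every integer n ≥ 3 one has s_1 ≥ (n/(2π)) · ln(n/2); consequently s_1 > n whenever ln(n/2) > 2π, in particular for every n ≥ 1072. -/
/-- The sum `s_1 = (1/4) ∑_{j=1}^{n-1} 1 / sin(j π/n)` (Newtonian exponent `α = 2`). -/
noncomputable def sOne (n : ℕ) : ℝ :=
  (1 / 4) * ∑ j ∈ Finset.Ico 1 n, 1 / Real.sin ((j : ℝ) * Real.pi / n)

/-- Half of the cosecant sum already dominates a harmonic number. -/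
lemma harmonic_le_sum_inv_sin {n m : ℕ} (hm : 2 * m < n) :
    (n : ℝ) / Real.pi * (harmonic m : ℝ) ≤
      ∑ j ∈ Finset.Ico 1 (m + 1), 1 / Real.sin ((j : ℝ) * Real.pi / n) := by
  have hn : (0 : ℝ) < n := by exact_mod_cast (by omega : 0 < n)
  rw [harmonic_eq_sum_Icc, ← Finset.Ico_add_one_right_eq_Icc]
  push_cast
  rw [Finset.mul_sum]
  refine Finset.sum_le_sum fun j hj ↦ ?_
  rw [Finset.mem_Ico] at hj
  have hj0 : (0 : ℝ) < j := by exact_mod_cast hj.1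
  have hjn : (j : ℝ) < n := by exact_mod_cast (by omega : j < n)
  have hx : 0 < (j : ℝ) * Real.pi / n := by positivity
  have hxpi : (j : ℝ) * Real.pi / n < Real.pi := by
    rw [div_lt_iff₀ hn]
    nlinarith [Real.pi_pos]
  calc (n : ℝ) / Real.pi * (j : ℝ)⁻¹ = 1 / ((j : ℝ) * Real.pi / n) := by
        field_simp
    _ ≤ 1 / Real.sin ((j : ℝ) * Real.pi / n) :=
        one_div_le_one_div_of_le (Real.sin_pos_of_pos_of_lt_pi hx hxpi) (Real.sin_lt hx).le

/-- The cosecant sum is at least twice its initial half, by the symmetry `j ↦ n - j`. -/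
lemma two_mul_sum_inv_sin_le {n m : ℕ} (hm : 2 * m < n) :
    2 * ∑ j ∈ Finset.Ico 1 (m + 1), 1 / Real.sin ((j : ℝ) * Real.pi / n) ≤
      ∑ j ∈ Finset.Ico 1 n, 1 / Real.sin ((j : ℝ) * Real.pi / n) := by
  have hn : (0 : ℝ) < n := by exact_mod_cast (by omega : 0 < n)
  have hreflect : ∑ j ∈ Finset.Ico (n - m) n, 1 / Real.sin ((j : ℝ) * Real.pi / n) =
      ∑ j ∈ Finset.Ico 1 (m + 1), 1 / Real.sin ((j : ℝ) * Real.pi / n) := by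
    refine Finset.sum_bij' (fun j _ ↦ n - j) (fun j _ ↦ n - j) ?_ ?_ ?_ ?_ ?_
    any_goals
      intro j hj
      simp only [Finset.mem_Ico] at hj ⊢
      omega
    intro j hj
    rw [Finset.mem_Ico] at hj
    rw [Nat.cast_sub hj.2.le, ← Real.sin_pi_sub]
    congr 2
    field_simp
  have hdisj : Disjoint (Finset.Ico 1 (m + 1)) (Finset.Ico (n - m) n) := by
    rw [Finset.disjoint_left]
    intro j hj hj'
    rw [Finset.mem_Ico] at hj hj'
    omega
  rw [two_mul]
  nth_rewrite 2 [← hreflect]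
  rw [← Finset.sum_union hdisj]
  refine Finset.sum_le_sum_of_subset_of_nonneg ?_ fun j hj _ ↦ ?_
  · intro j hj
    simp only [Finset.mem_union, Finset.mem_Ico] at hj ⊢
    omega
  · rw [Finset.mem_Ico] at hj
    have hjn : (j : ℝ) ≤ n := by exact_mod_cast hj.2.le
    refine one_div_nonneg.mpr (Real.sin_nonneg_of_nonneg_of_le_pi (by positivity) ?_)
    rw [div_le_iff₀ hn]
    nlinarith [Real.pi_pos]

lemma sOne_ge_mul_log {n : ℕ} (hn : 0 < n) :
    (n : ℝ) / (2 * Real.pi) * Real.log ((n : ℝ) / 2) ≤ sOne n := by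
  have hn0 : (0 : ℝ) < n := by exact_mod_cast hn
  obtain ⟨m, hm, hm'⟩ : ∃ m, 2 * m < n ∧ n ≤ 2 * (m + 1) := ⟨(n - 1) / 2, by omega, by omega⟩
  have hlog : Real.log ((n : ℝ) / 2) ≤ harmonic m := by
    refine le_trans (Real.log_le_log (by positivity) ?_) (log_add_one_le_harmonic m)
    have : (n : ℝ) ≤ 2 * (m + 1) := by exact_mod_cast hm'
    push_cast
    linarith
  calc (n : ℝ) / (2 * Real.pi) * Real.log ((n : ℝ) / 2)
      ≤ (n : ℝ) / (2 * Real.pi) * harmonic m := by gcongr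
    _ = 1 / 4 * (2 * ((n : ℝ) / Real.pi * harmonic m)) := by ring
    _ ≤ sOne n := by
        unfold sOne
        gcongr
        exact (mul_le_mul_of_nonneg_left (harmonic_le_sum_inv_sin hm) zero_le_two).trans
          (two_mul_sum_inv_sin_le hm)

lemma two_mul_pi_lt_log_536 : 2 * Real.pi < Real.log 536 := by
  rw [Real.lt_log_iff_exp_lt (by norm_num)]
  have hfrac : Real.exp 0.283186 ≤ 1.3275 := by
    refine (Real.exp_bound' (by norm_num) (by norm_num) (n := 5) (by norm_num)).trans ?_
    norm_num [Finset.sum_range_succ, Nat.factorial]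
  calc Real.exp (2 * Real.pi) ≤ Real.exp (6 * 1 + 0.283186) := by
        gcongr
        linarith [Real.pi_lt_d6]
    _ = Real.exp 1 ^ 6 * Real.exp 0.283186 := by
        rw [Real.exp_add, ← Real.exp_nat_mul]
        norm_num
    _ ≤ 2.7182818286 ^ 6 * 1.3275 := by
        gcongr
        exact Real.exp_one_lt_d9.le
    _ < 536 := by norm_num

/-- For every `n ≥ 3` one has `s_1 ≥ (n/(2π)) ln(n/2)`; consequently `s_1 > n` whenever
`ln(n/2) > 2π`, in particular for every `n ≥ 1072`. -/
theorem sOne_lower_bound (n : ℕ) (hn : 3 ≤ n) :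
    ((n : ℝ) / (2 * Real.pi)) * Real.log ((n : ℝ) / 2) ≤ sOne n ∧
    (2 * Real.pi < Real.log ((n : ℝ) / 2) → (n : ℝ) < sOne n) ∧
    (1072 ≤ n → (n : ℝ) < sOne n) := by
  have hn0 : (0 : ℝ) < n := by exact_mod_cast (by omega : 0 < n)
  have hbound := sOne_ge_mul_log (n := n) (by omega)
  have hlt : 2 * Real.pi < Real.log ((n : ℝ) / 2) → (n : ℝ) < sOne n := fun h ↦
    calc (n : ℝ) = n / (2 * Real.pi) * (2 * Real.pi) := by field_simp
      _ < n / (2 * Real.pi) * Real.log ((n : ℝ) / 2) := by gcongr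
      _ ≤ sOne n := hbound
  refine ⟨hbound, hlt, fun h ↦ hlt (two_mul_pi_lt_log_536.trans_le ?_)⟩
  have : (1072 : ℝ) ≤ n := by exact_mod_cast h
  exact Real.log_le_log (by norm_num) (by linarith)
end

section
/- With s_1(n) = (1/4) ∑_{j=1}^{n−1} 1/sin(j π/n), one has lim_{n→∞} s_1(n)/(n ln n) = 1/(2π). -/
theorem abs_one_div_sin_sub_le_of_le_pi_div_two {x : ℝ} (h0 : 0 < x) (h1 : x ≤ Real.pi / 2) :
    |1 / Real.sin x - (1 / x + 1 / (Real.pi - x))| ≤ 1 := by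
  have hpi := Real.pi_gt_three
  have hpi' := Real.pi_lt_d2
  have hs : 0 < Real.sin x := Real.sin_pos_of_pos_of_lt_pi h0 (by linarith)
  have hlow : 1 / x ≤ 1 / Real.sin x := one_div_le_one_div_of_le hs (Real.sin_le h0.le)
  have hrefl0 : 0 ≤ 1 / (Real.pi - x) := by
    apply one_div_nonneg.mpr
    linarith
  have hrefl1 : 1 / (Real.pi - x) ≤ 1 := by
    rw [div_le_one (by linarith)]
    linarith
  have hupp : 1 / Real.sin x ≤ 1 / x + 1 := by
    have hcube := Real.sin_gt_sub_cube h0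
    have hsin : x / 2 ≤ Real.sin x := by
      refine le_trans ?_ (Real.mul_le_sin h0.le h1)
      have : 1 / 2 ≤ 2 / Real.pi := by
        rw [div_le_div_iff₀ (by norm_num) Real.pi_pos]
        linarith
      nlinarith
    have hx2 : x ≤ 2 := by linarith
    rw [div_add_one h0.ne', div_le_div_iff₀ hs h0]
    nlinarith [mul_le_mul_of_nonneg_left hsin h0.le, mul_nonneg (sq_nonneg x) (sub_nonneg.mpr hx2)]
  rw [abs_le]
  constructor <;> linarith

theorem abs_one_div_sin_sub_le {x : ℝ} (h0 : 0 < x) (h1 : x < Real.pi) :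
    |1 / Real.sin x - (1 / x + 1 / (Real.pi - x))| ≤ 1 := by
  rcases le_total x (Real.pi / 2) with h | h
  · exact abs_one_div_sin_sub_le_of_le_pi_div_two h0 h
  · have := abs_one_div_sin_sub_le_of_le_pi_div_two (x := Real.pi - x) (by linarith) (by linarith)
    rwa [Real.sin_pi_sub, sub_sub_cancel, add_comm (1 / (Real.pi - x))] at this

theorem sum_Ico_one_div_eq_harmonic {n : ℕ} (hn : 1 ≤ n) :
    ∑ j ∈ Finset.Ico 1 n, 1 / (j : ℝ) = (harmonic (n - 1) : ℝ) := by
  obtain ⟨m, rfl⟩ := Nat.exists_eq_add_of_le' hn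
  rw [harmonic, Finset.sum_Ico_eq_sum_range]
  push_cast
  simp [add_comm]

theorem sum_Ico_one_div_sub_eq {n : ℕ} :
    ∑ j ∈ Finset.Ico 1 n, 1 / ((n : ℝ) - j) = ∑ j ∈ Finset.Ico 1 n, 1 / (j : ℝ) := by
  refine Finset.sum_bij' (fun j _ => n - j) (fun j _ => n - j) ?_ ?_ ?_ ?_ ?_ <;>
    intro j hj <;> rw [Finset.mem_Ico] at hj
  · rw [Finset.mem_Ico]
    omega
  · rw [Finset.mem_Ico]
    omega
  · omega
  · omega
  · rw [Nat.cast_sub hj.2.le]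

theorem abs_sOne_sub_harmonic_le {n : ℕ} (hn : 1 ≤ n) :
    |sOne n - n * (harmonic (n - 1) : ℝ) / (2 * Real.pi)| ≤ n / 4 := by
  have hn0 : (0 : ℝ) < n := by exact_mod_cast hn
  have hpi := Real.pi_pos
  have hsum : sOne n - n * (harmonic (n - 1) : ℝ) / (2 * Real.pi) =
      (1 / 4) * ∑ j ∈ Finset.Ico 1 n, (1 / Real.sin ((j : ℝ) * Real.pi / n) -
        (1 / ((j : ℝ) * Real.pi / n) + 1 / (Real.pi - (j : ℝ) * Real.pi / n))) := by
    have hterm : ∀ j ∈ Finset.Ico 1 n,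
        1 / ((j : ℝ) * Real.pi / n) + 1 / (Real.pi - (j : ℝ) * Real.pi / n) =
          (n / Real.pi) * (1 / (j : ℝ) + 1 / ((n : ℝ) - j)) := by
      intro j hj
      rw [Finset.mem_Ico] at hj
      have hj0 : (0 : ℝ) < j := by exact_mod_cast hj.1
      have hj1 : (0 : ℝ) < n - j := sub_pos.mpr (by exact_mod_cast hj.2)
      have hrefl : Real.pi - (j : ℝ) * Real.pi / n = ((n : ℝ) - j) * Real.pi / n := by
        field_simp
      rw [hrefl]
      field_simp
    rw [Finset.sum_sub_distrib, Finset.sum_congr rfl hterm, ← Finset.mul_sum,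
      Finset.sum_add_distrib, sum_Ico_one_div_sub_eq, sum_Ico_one_div_eq_harmonic hn, sOne]
    generalize ∑ j ∈ Finset.Ico 1 n, 1 / Real.sin ((j : ℝ) * Real.pi / n) = S
    field_simp
    ring
  have hbound : |∑ j ∈ Finset.Ico 1 n, (1 / Real.sin ((j : ℝ) * Real.pi / n) -
      (1 / ((j : ℝ) * Real.pi / n) + 1 / (Real.pi - (j : ℝ) * Real.pi / n)))| ≤ n := by
    refine (Finset.abs_sum_le_sum_abs _ _).trans ?_
    refine (Finset.sum_le_card_nsmul _ _ 1 ?_).trans ?_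
    · intro j hj
      rw [Finset.mem_Ico] at hj
      have hj0 : (0 : ℝ) < j := by exact_mod_cast hj.1
      have hj1 : (j : ℝ) < n := by exact_mod_cast hj.2
      refine abs_one_div_sin_sub_le (by positivity) ?_
      rw [div_lt_iff₀ hn0]
      nlinarith
    · simp
  rw [hsum, abs_mul, abs_of_pos (by norm_num : (0 : ℝ) < 1 / 4)]
  linarith

theorem abs_harmonic_sub_log_le {n : ℕ} (hn : 2 ≤ n) :
    |(harmonic (n - 1) : ℝ) - Real.log n| ≤ 1 := by
  obtain ⟨m, rfl⟩ := Nat.exists_eq_add_of_le' (show 1 ≤ n by omega)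
  rw [Nat.add_sub_cancel]
  have hlow := log_add_one_le_harmonic m
  have hupp := harmonic_le_one_add_log m
  have hm : (0 : ℝ) < m := by exact_mod_cast (show 0 < m by omega)
  have hlog : Real.log m ≤ Real.log ((m + 1 : ℕ) : ℝ) :=
    Real.log_le_log hm (by push_cast; linarith)
  push_cast at *
  rw [abs_le]
  constructor <;> linarith

theorem abs_sOne_sub_le {n : ℕ} (hn : 2 ≤ n) :
    |sOne n - n * Real.log n / (2 * Real.pi)| ≤ n := by
  have hn0 : (0 : ℝ) < n := by exact_mod_cast (show 0 < n by omega)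
  have hpi := Real.pi_gt_three
  have hharm : |n * (harmonic (n - 1) : ℝ) / (2 * Real.pi) - n * Real.log n / (2 * Real.pi)| ≤
      n / 2 := by
    rw [← sub_div, ← mul_sub, abs_div, abs_mul, abs_of_pos hn0,
      abs_of_pos (show 0 < 2 * Real.pi by positivity)]
    refine div_le_div₀ hn0.le ?_ (by norm_num) (by linarith)
    exact mul_le_of_le_one_right hn0.le (abs_harmonic_sub_log_le hn)
  have := abs_sub_le (sOne n) (n * (harmonic (n - 1) : ℝ) / (2 * Real.pi))
    (n * Real.log n / (2 * Real.pi))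
  linarith [abs_sOne_sub_harmonic_le (show 1 ≤ n by omega)]

/-- The asymptotics of the sum `s_1`: `lim_{n→∞} s_1(n)/(n ln n) = 1/(2π)`. -/
theorem sOne_asymptotics :
    Filter.Tendsto (fun n : ℕ => sOne n / ((n : ℝ) * Real.log n))
      Filter.atTop (nhds (1 / (2 * Real.pi))) := by
  rw [tendsto_iff_dist_tendsto_zero]
  have hlim : Filter.Tendsto (fun n : ℕ => (Real.log n)⁻¹) Filter.atTop (nhds 0) :=
    (Real.tendsto_log_atTop.comp tendsto_natCast_atTop_atTop).inv_tendsto_atTop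
  refine squeeze_zero' (.of_forall fun _ => dist_nonneg) ?_ hlim
  filter_upwards [Filter.eventually_ge_atTop 2] with n hn
  have hn1 : (1 : ℝ) < n := by exact_mod_cast (show 1 < n by omega)
  have hn0 : (0 : ℝ) < n := by linarith
  have hlog : 0 < Real.log n := Real.log_pos hn1
  have hpi := Real.pi_pos
  have hdiff : sOne n / ((n : ℝ) * Real.log n) - 1 / (2 * Real.pi) =
      (sOne n - n * Real.log n / (2 * Real.pi)) / (n * Real.log n) := by
    field_simp
  rw [Real.dist_eq, hdiff, abs_div, abs_of_pos (mul_pos hn0 hlog), div_le_iff₀ (mul_pos hn0 hlog)]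
  refine (abs_sOne_sub_le hn).trans_eq ?_
  field_simp
end

section
/- For even n, s_{n/2} = (1/4) ∑_{j odd, 1 ≤ j ≤ n−1} 1/sin³(j π/n), and as n → ∞ through even integers, s_{n/2}/n³ converges to σ = (1/(2π³)) ∑_{k=1}^{∞} 1/(2k−1)³. -/
/-- The constant `σ = (1/(2π³)) ∑_{k=1}^∞ 1/(2k−1)³`. -/
noncomputable def sigmaConst : ℝ :=
  (1 / (2 * Real.pi ^ 3)) * ∑' k : ℕ, 1 / (2 * (k : ℝ) + 1) ^ 3

open Filter Topology

theorem sin_sq_nat_mul_pi_div_two (j : ℕ) :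
    Real.sin ((j : ℝ) * Real.pi / 2) ^ 2 = if Odd j then 1 else 0 := by
  rw [Real.sin_sq_eq_half_sub, show 2 * ((j : ℝ) * Real.pi / 2) = j * Real.pi by ring,
    Real.cos_nat_mul_pi]
  split_ifs with h
  · rw [h.neg_one_pow]; norm_num
  · rw [(Nat.not_odd_iff_even.mp h).neg_one_pow]; norm_num

theorem sN_two_mul_self (m : ℕ) (hm : m ≠ 0) :
    sN (2 * m) m = (1 / 4) * ∑ j ∈ (Finset.Ico 1 (2 * m)).filter (fun j => Odd j),
      1 / Real.sin ((j : ℝ) * Real.pi / (2 * m : ℕ)) ^ 3 := by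
  rw [sN, Finset.sum_filter]
  congr 1
  refine Finset.sum_congr rfl fun j _ => ?_
  have hm' : (m : ℝ) ≠ 0 := Nat.cast_ne_zero.mpr hm
  have harg : (m : ℝ) * j * Real.pi / (2 * m : ℕ) = j * Real.pi / 2 := by
    push_cast
    field_simp
  rw [harg, sin_sq_nat_mul_pi_div_two]
  split_ifs <;> simp

theorem sum_odd_Ico_one_two_mul (m : ℕ) (f : ℕ → ℝ) :
    ∑ j ∈ (Finset.Ico 1 (2 * m)).filter (fun j => Odd j), f j =
      ∑ i ∈ Finset.range m, f (2 * i + 1) := by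
  symm
  refine Finset.sum_nbij' (fun i => 2 * i + 1) (fun j => j / 2) ?_ ?_ ?_ ?_ ?_
  · intro i hi
    simp only [Finset.mem_range, Finset.mem_filter, Finset.mem_Ico] at *
    exact ⟨by omega, i, rfl⟩
  · intro j hj
    simp only [Finset.mem_range, Finset.mem_filter, Finset.mem_Ico] at *
    omega
  · intro i _
    omega
  · intro j hj
    obtain ⟨k, rfl⟩ := (Finset.mem_filter.mp hj).2
    omega
  · intro i _
    rfl

/-- The weight selecting the half `2 * i + 1 ≤ m` of the odd residues modulo `2 * m`, the fixed
point of the reflection `i ↦ m - 1 - i` being counted with weight one half. -/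
noncomputable def halfWeight (m i : ℕ) : ℝ :=
  if 2 * i + 1 < m then 1 else if 2 * i + 1 = m then 1 / 2 else 0

theorem halfWeight_nonneg (m i : ℕ) : 0 ≤ halfWeight m i := by
  unfold halfWeight
  split_ifs <;> norm_num

theorem halfWeight_le_one (m i : ℕ) : halfWeight m i ≤ 1 := by
  unfold halfWeight
  split_ifs <;> norm_num

theorem halfWeight_eq_zero {m i : ℕ} (h : m < 2 * i + 1) : halfWeight m i = 0 := by
  rw [halfWeight, if_neg (by omega), if_neg (by omega)]

theorem halfWeight_add_reflect {m i : ℕ} (h : i < m) :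
    halfWeight m i + halfWeight m (m - 1 - i) = 1 := by
  unfold halfWeight
  split_ifs <;> first | omega | norm_num

theorem sum_eq_two_mul_sum_halfWeight (m : ℕ) (f : ℕ → ℝ)
    (hf : ∀ i < m, f (m - 1 - i) = f i) :
    ∑ i ∈ Finset.range m, f i = 2 * ∑ i ∈ Finset.range m, halfWeight m i * f i := by
  have hreflect := Finset.sum_range_reflect (fun i => halfWeight m i * f i) m
  rw [two_mul]
  nth_rewrite 1 [← hreflect]
  rw [← Finset.sum_add_distrib]
  refine Finset.sum_congr rfl fun i hi => ?_
  have hi := Finset.mem_range.mp hi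
  rw [hf i hi, ← add_mul, add_comm, halfWeight_add_reflect hi, one_mul]

theorem sin_odd_mul_pi_reflect {m i : ℕ} (h : i < m) :
    Real.sin (((2 * (m - 1 - i) + 1 : ℕ) : ℝ) * Real.pi / (2 * m : ℕ)) =
      Real.sin (((2 * i + 1 : ℕ) : ℝ) * Real.pi / (2 * m : ℕ)) := by
  have hm : (m : ℝ) ≠ 0 := Nat.cast_ne_zero.mpr (by omega)
  rw [← Real.sin_pi_sub]
  congr 1
  have hcast : ((2 * (m - 1 - i) + 1 : ℕ) : ℝ) = 2 * m - (2 * i + 1) := by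
    rw [eq_sub_iff_add_eq]
    exact_mod_cast (by omega : 2 * (m - 1 - i) + 1 + (2 * i + 1) = 2 * m)
  rw [hcast]
  push_cast
  field_simp
  ring

/-- The folded and rescaled summand of `sN (2 * m) m`. -/
noncomputable def foldedTerm (m i : ℕ) : ℝ :=
  halfWeight m i / (2 * m * Real.sin ((2 * i + 1) * Real.pi / (2 * m))) ^ 3

theorem sN_two_mul_self_div (m : ℕ) (hm : m ≠ 0) :
    sN (2 * m) m / (2 * (m : ℝ)) ^ 3 = (1 / 2) * ∑' i, foldedTerm m i := by
  rw [sN_two_mul_self m hm,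
    sum_odd_Ico_one_two_mul m fun j => 1 / Real.sin ((j : ℝ) * Real.pi / (2 * m : ℕ)) ^ 3,
    sum_eq_two_mul_sum_halfWeight m _ fun i hi => by rw [sin_odd_mul_pi_reflect hi],
    tsum_eq_sum (s := Finset.range m)]
  · rw [← mul_assoc, mul_div_assoc, Finset.sum_div]
    congr 1
    · norm_num
    · refine Finset.sum_congr rfl fun i _ => ?_
      rw [foldedTerm, mul_pow _ (Real.sin _)]
      push_cast
      rw [mul_one_div, div_div, mul_comm (Real.sin _ ^ 3)]
  · intro i hi
    have hi : ¬ i < m := by simpa using hi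
    rw [foldedTerm, halfWeight_eq_zero (by omega), zero_div]

theorem norm_foldedTerm_le (m i : ℕ) : ‖foldedTerm m i‖ ≤ 1 / (2 * (i : ℝ) + 1) ^ 3 := by
  rcases lt_or_ge m (2 * i + 1) with h | h
  · rw [foldedTerm, halfWeight_eq_zero h, zero_div, norm_zero]
    positivity
  · have hm : (0 : ℝ) < m := Nat.cast_pos.mpr (by omega)
    have h' : (2 * i + 1 : ℝ) ≤ m := by exact_mod_cast h
    have hsin : 2 / Real.pi * ((2 * i + 1) * Real.pi / (2 * m)) ≤
        Real.sin ((2 * i + 1) * Real.pi / (2 * m)) := by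
      refine Real.mul_le_sin (by positivity) ?_
      rw [div_le_div_iff₀ (by positivity) (by norm_num)]
      nlinarith [Real.pi_pos]
    have hbound : (2 * i + 1 : ℝ) ≤ 2 * m * Real.sin ((2 * i + 1) * Real.pi / (2 * m)) := by
      have heq : 2 / Real.pi * ((2 * i + 1) * Real.pi / (2 * m)) = (2 * i + 1) / (m : ℝ) := by
        field_simp
      rw [heq, div_le_iff₀ hm] at hsin
      have : (0 : ℝ) ≤ i := i.cast_nonneg
      linarith
    have hpos : (0 : ℝ) < 2 * i + 1 := by positivity
    have hnonneg : 0 ≤ foldedTerm m i :=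
      div_nonneg (halfWeight_nonneg m i) (pow_nonneg (hpos.le.trans hbound) 3)
    rw [Real.norm_of_nonneg hnonneg]
    exact div_le_div₀ zero_le_one (halfWeight_le_one m i) (by positivity)
      (pow_le_pow_left₀ hpos.le hbound 3)

theorem tendsto_two_mul_mul_sin_div (a : ℝ) :
    Tendsto (fun m : ℕ => 2 * (m : ℝ) * Real.sin (a / (2 * m))) atTop (𝓝 a) := by
  have harg : Tendsto (fun m : ℕ => a / (2 * (m : ℝ))) atTop (𝓝 0) :=
    (tendsto_natCast_atTop_atTop.const_mul_atTop two_pos).const_div_atTop a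
  have hsinc := ((Real.continuous_sinc.tendsto 0).comp harg).const_mul a
  rw [Real.sinc_zero, mul_one] at hsinc
  refine hsinc.congr' ?_
  filter_upwards [eventually_ne_atTop 0] with m hm
  have hm : (m : ℝ) ≠ 0 := Nat.cast_ne_zero.mpr hm
  rcases eq_or_ne a 0 with rfl | ha
  · simp
  · rw [Function.comp_apply, Real.sinc_of_ne_zero (by positivity)]
    field_simp

theorem tendsto_foldedTerm (i : ℕ) :
    Tendsto (fun m => foldedTerm m i) atTop (𝓝 (1 / ((2 * i + 1) * Real.pi) ^ 3)) := by
  have hpi := Real.pi_pos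
  refine (tendsto_const_nhds.div ((tendsto_two_mul_mul_sin_div ((2 * i + 1) * Real.pi)).pow 3)
    (by positivity)).congr' ?_
  filter_upwards [eventually_gt_atTop (2 * i + 1)] with m hm
  rw [foldedTerm, halfWeight, if_pos hm, Pi.div_apply]

theorem summable_one_div_odd_pow_three :
    Summable fun i : ℕ => 1 / (2 * (i : ℝ) + 1) ^ 3 := by
  have h := (Real.summable_one_div_nat_pow.mpr (by norm_num : 1 < 3)).comp_injective
    (i := fun i : ℕ => 2 * i + 1) fun a b hab => by simpa using hab
  simpa [Function.comp_def] using h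

theorem tendsto_sN_two_mul_self_div :
    Tendsto (fun m : ℕ => sN (2 * m) m / (2 * (m : ℝ)) ^ 3) atTop (𝓝 sigmaConst) := by
  have hlim := (tendsto_tsum_of_dominated_convergence summable_one_div_odd_pow_three
    tendsto_foldedTerm (Eventually.of_forall norm_foldedTerm_le)).const_mul (1 / 2)
  have hsigma : sigmaConst = 1 / 2 * ∑' i : ℕ, 1 / ((2 * (i : ℝ) + 1) * Real.pi) ^ 3 := by
    rw [sigmaConst, ← tsum_mul_left, ← tsum_mul_left]
    refine tsum_congr fun i => ?_
    rw [mul_pow]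
    field_simp
  rw [hsigma]
  refine hlim.congr' ?_
  filter_upwards [eventually_ne_atTop 0] with m hm
  exact (sN_two_mul_self_div m hm).symm

/-- For even `n`, `s_{n/2} = (1/4) ∑_{j odd, 1 ≤ j ≤ n−1} 1/sin³(j π/n)`, and as `n → ∞`
through even integers `n = 2m`, `s_{n/2}/n³` converges to `σ = (1/(2π³)) ∑_{k≥1} 1/(2k−1)³`. -/
theorem sN_half_asymptotics :
    (∀ n : ℕ, 2 ≤ n → Even n →
      sN n (n / 2) = (1 / 4) * ∑ j ∈ (Finset.Ico 1 n).filter (fun j => Odd j),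
        1 / Real.sin ((j : ℝ) * Real.pi / n) ^ 3) ∧
    Filter.Tendsto (fun m : ℕ => sN (2 * m) m / (2 * (m : ℝ)) ^ 3)
      Filter.atTop (nhds sigmaConst) := by
  refine ⟨fun n hn heven => ?_, tendsto_sN_two_mul_self_div⟩
  obtain ⟨m, rfl⟩ := heven.two_dvd
  rw [Nat.mul_div_cancel_left m two_pos]
  exact sN_two_mul_self m (by omega)
end

section
/- For all integers n ≥ 2 and k with 1 ≤ k ≤ n−1, and every real α ≥ 1, one has the identity of complex numbers ∑_{j=1}^{n−1} (e^{2πijk/n} − 1)/(2 sin(j π/n))^{α+1} = −s_k. In particular the imaginary part of the left-hand side vanishes. -/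
/-- A sum over `1 ≤ j < n` of a function that is odd under `j ↦ n - j` vanishes. -/
theorem sum_Ico_one_eq_zero_of_odd_reflect (n : ℕ) (f : ℕ → ℝ)
    (hf : ∀ j ∈ Finset.Ico 1 n, f (n - j) = -f j) : ∑ j ∈ Finset.Ico 1 n, f j = 0 := by
  have h : ∑ j ∈ Finset.Ico 1 n, f j = ∑ j ∈ Finset.Ico 1 n, -f j := by
    refine Finset.sum_nbij' (fun j => n - j) (fun j => n - j) ?_ ?_ ?_ ?_ ?_
    · intro j hj; simp only [Finset.mem_Ico] at hj ⊢; omega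
    · intro j hj; simp only [Finset.mem_Ico] at hj ⊢; omega
    · intro j hj; simp only [Finset.mem_Ico] at hj ⊢; omega
    · intro j hj; simp only [Finset.mem_Ico] at hj ⊢; omega
    · intro j hj; rw [hf j hj, neg_neg]
  rw [Finset.sum_neg_distrib] at h
  linarith

theorem Complex.exp_two_mul_I_sub_one (x : ℝ) :
    Complex.exp (2 * x * Complex.I) - 1
      = ((-2 * Real.sin x ^ 2 : ℝ) : ℂ) + ((Real.sin (2 * x) : ℝ) : ℂ) * Complex.I := by
  have h : Real.cos (2 * x) = 1 - 2 * Real.sin x ^ 2 := by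
    rw [Real.cos_two_mul, Real.cos_sq']; ring
  have h' : Complex.exp (2 * x * Complex.I)
      = ((Real.cos (2 * x) : ℝ) : ℂ) + ((Real.sin (2 * x) : ℝ) : ℂ) * Complex.I := by
    rw [Complex.exp_mul_I]; push_cast; rfl
  rw [h', h]
  push_cast
  ring

theorem sum_sin_div_rpow_eq_zero (n : ℕ) (hn : n ≠ 0) (k : ℤ) (β : ℝ) :
    ∑ j ∈ Finset.Ico 1 n, Real.sin (2 * ((k : ℝ) * j * Real.pi / n)) /
      (2 * Real.sin ((j : ℝ) * Real.pi / n)) ^ β = 0 := by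
  have hn' : (n : ℝ) ≠ 0 := Nat.cast_ne_zero.mpr hn
  refine sum_Ico_one_eq_zero_of_odd_reflect n
    (fun j => Real.sin (2 * ((k : ℝ) * j * Real.pi / n)) /
      (2 * Real.sin ((j : ℝ) * Real.pi / n)) ^ β) fun j hj => ?_
  have hjn : j ≤ n := (Finset.mem_Ico.mp hj).2.le
  have h₁ : 2 * ((k : ℝ) * ((n - j : ℕ) : ℝ) * Real.pi / n)
      = k * (2 * Real.pi) - 2 * ((k : ℝ) * j * Real.pi / n) := by
    rw [Nat.cast_sub hjn]; field_simp
  have h₂ : ((n - j : ℕ) : ℝ) * Real.pi / n = Real.pi - (j : ℝ) * Real.pi / n := by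
    rw [Nat.cast_sub hjn]; field_simp
  simp only [h₁, h₂, Real.sin_pi_sub, Real.sin_int_mul_two_pi_sub, neg_div]

/-- **Key identity for the spatial blocks.** For `n ≥ 2`, `1 ≤ k ≤ n−1` and `α ≥ 1`,
`∑_{j=1}^{n−1} (e^{2πijk/n} − 1)/(2 sin(j π/n))^{α+1} = −s_k` as complex numbers; in particular
the imaginary part of the left-hand side vanishes. -/
theorem sum_exp_sub_one_div_eq_neg_sSum (n : ℕ) (hn : 2 ≤ n) (k : ℤ)
    (hk1 : 1 ≤ k) (hk2 : k ≤ (n : ℤ) - 1) (α : ℝ) (hα : 1 ≤ α) :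
    (∑ j ∈ Finset.Ico 1 n,
        (Complex.exp (2 * Real.pi * Complex.I * k * j / n) - 1) /
          (((2 * Real.sin ((j : ℝ) * Real.pi / n)) ^ (α + 1) : ℝ) : ℂ))
      = -((sSum n α k : ℝ) : ℂ) ∧
    (∑ j ∈ Finset.Ico 1 n,
        (Complex.exp (2 * Real.pi * Complex.I * k * j / n) - 1) /
          (((2 * Real.sin ((j : ℝ) * Real.pi / n)) ^ (α + 1) : ℝ) : ℂ)).im = 0 := by
  have hn0 : n ≠ 0 := by omega
  have hsum : (∑ j ∈ Finset.Ico 1 n,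
        (Complex.exp (2 * Real.pi * Complex.I * k * j / n) - 1) /
          (((2 * Real.sin ((j : ℝ) * Real.pi / n)) ^ (α + 1) : ℝ) : ℂ))
      = -((sSum n α k : ℝ) : ℂ) := by
    have hterm : ∀ j ∈ Finset.Ico 1 n,
        (Complex.exp (2 * Real.pi * Complex.I * k * j / n) - 1) /
          (((2 * Real.sin ((j : ℝ) * Real.pi / n)) ^ (α + 1) : ℝ) : ℂ)
        = ((-((2 : ℝ) ^ (-α) * (Real.sin ((k : ℝ) * j * Real.pi / n) ^ 2 /
              Real.sin ((j : ℝ) * Real.pi / n) ^ (α + 1))) : ℝ) : ℂ)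
          + ((Real.sin (2 * ((k : ℝ) * j * Real.pi / n)) /
              (2 * Real.sin ((j : ℝ) * Real.pi / n)) ^ (α + 1) : ℝ) : ℂ) * Complex.I := by
      intro j hj
      obtain ⟨-, hjn⟩ := Finset.mem_Ico.mp hj
      have hsin : 0 ≤ Real.sin ((j : ℝ) * Real.pi / n) := by
        apply Real.sin_nonneg_of_nonneg_of_le_pi (by positivity)
        rw [div_le_iff₀ (by positivity), mul_comm]
        gcongr
      have hreal : -((2 : ℝ) ^ (-α) * (Real.sin ((k : ℝ) * j * Real.pi / n) ^ 2 /
              Real.sin ((j : ℝ) * Real.pi / n) ^ (α + 1)))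
          = (-2 * Real.sin ((k : ℝ) * j * Real.pi / n) ^ 2) /
            (2 * Real.sin ((j : ℝ) * Real.pi / n)) ^ (α + 1) := by
        rw [Real.mul_rpow zero_le_two hsin, Real.rpow_neg zero_le_two,
          Real.rpow_add_one two_ne_zero, ← div_div, mul_comm ((2 : ℝ) ^ α) 2, ← div_div]
        ring
      have hexp : (2 * Real.pi * Complex.I * k * j / n : ℂ)
          = 2 * (((k : ℝ) * j * Real.pi / n : ℝ) : ℂ) * Complex.I := by
        push_cast; ring
      rw [hexp, Complex.exp_two_mul_I_sub_one, hreal, Complex.ofReal_div, Complex.ofReal_div]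
      ring
    rw [Finset.sum_congr rfl hterm, Finset.sum_add_distrib, ← Finset.sum_mul,
      ← Complex.ofReal_sum, ← Complex.ofReal_sum, sum_sin_div_rpow_eq_zero n hn0 k (α + 1),
      Finset.sum_neg_distrib, ← Finset.mul_sum, sSum]
    simp only [Complex.ofReal_neg, Complex.ofReal_zero, zero_mul, add_zero]
  exact ⟨hsum, by rw [hsum, ← Complex.ofReal_neg, Complex.ofReal_im]⟩
end

section
/- Let μ > 0 and consider the real quartic polynomial d_1(ν) = (16μ² + 8μ + 1)ν⁴ + (−16μ² + 20μ + 6)ν² − (84μ + 119). Then d_1(ν) = 0 if and only if ν = ν_1 or ν = −ν_1, where ν_1 is the unique positive real number with ν_1² = (2μ − 3 + 2√(μ² + 18μ + 32))/(4μ + 1); moreover ν_1 > 1. -/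
/-- **The case `n = 2`.** For `μ > 0`, the quartic
`d₁(ν) = (16μ² + 8μ + 1)ν⁴ + (−16μ² + 20μ + 6)ν² − (84μ + 119)` vanishes exactly at `±ν₁`, where
`ν₁` is the unique positive real with `ν₁² = (2μ − 3 + 2√(μ² + 18μ + 32))/(4μ + 1)`; moreover
`ν₁ > 1`. -/
theorem quartic_roots_n_two (μ : ℝ) (hμ : 0 < μ) :
    ∃ ν₁ : ℝ, 0 < ν₁ ∧
      ν₁ ^ 2 = (2 * μ - 3 + 2 * Real.sqrt (μ ^ 2 + 18 * μ + 32)) / (4 * μ + 1) ∧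
      1 < ν₁ ∧
      ∀ ν : ℝ,
        (16 * μ ^ 2 + 8 * μ + 1) * ν ^ 4 + (-16 * μ ^ 2 + 20 * μ + 6) * ν ^ 2
            - (84 * μ + 119) = 0
          ↔ ν = ν₁ ∨ ν = -ν₁ := by
  have hd : 0 < 4 * μ + 1 := by linarith
  have hs2 : Real.sqrt (μ ^ 2 + 18 * μ + 32) ^ 2 = μ ^ 2 + 18 * μ + 32 :=
    Real.sq_sqrt (by positivity)
  have hs : μ + 2 < Real.sqrt (μ ^ 2 + 18 * μ + 32) :=
    Real.lt_sqrt_of_sq_lt (by nlinarith)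
  set s := Real.sqrt (μ ^ 2 + 18 * μ + 32)
  set x := (2 * μ - 3 + 2 * s) / (4 * μ + 1) with hx
  have hx1 : 1 < x := by
    rw [hx, one_lt_div hd]
    linarith
  have hxd : (4 * μ + 1) * x = 2 * μ - 3 + 2 * s := mul_div_cancel₀ _ hd.ne'
  have hsq : Real.sqrt x ^ 2 = x := Real.sq_sqrt (by linarith)
  refine ⟨Real.sqrt x, Real.sqrt_pos.2 (by linarith), hsq, ?_, fun ν => ?_⟩
  · exact Real.lt_sqrt_of_sq_lt (by linarith)
  have factor : (16 * μ ^ 2 + 8 * μ + 1) * ν ^ 4 + (-16 * μ ^ 2 + 20 * μ + 6) * ν ^ 2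
      - (84 * μ + 119)
      = (4 * μ + 1) * (ν ^ 2 - x) * ((4 * μ + 1) * ν ^ 2 + (2 * s - 2 * μ + 3)) := by
    linear_combination ((4 * μ + 1) * ν ^ 2 + (2 * s - 2 * μ + 3)) * hxd + 4 * hs2
  have hpos : 0 < (4 * μ + 1) * ν ^ 2 + (2 * s - 2 * μ + 3) := by
    have : 0 ≤ (4 * μ + 1) * ν ^ 2 := by positivity
    linarith
  rw [factor, mul_eq_zero, or_iff_left hpos.ne', mul_eq_zero, or_iff_right hd.ne', sub_eq_zero,
    ← sq_eq_sq_iff_eq_or_eq_neg, hsq]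
end

section
/- Let n ≥ 2 and k be integers, ζ = 2π/n, and let u : ℝ → ℂ be a 2π-periodic function satisfying u(t) = e^{−ilζ} u(t − k l ζ) for all t ∈ ℝ and all integers l. Let h = gcd(n, k). If h > 1, then u is identically zero. If h = 1 and k′ is an integer with k k′ ≡ 1 (mod n), then u(t + ζ) = e^{−ik′ζ} u(t) for all t ∈ ℝ. -/
/-- **Symmetries of the central body.** Let `ζ = 2π/n` and let `u : ℝ → ℂ` be `2π`-periodic with
`u(t) = e^{−ilζ} u(t − k l ζ)` for all `t` and all integers `l`. If `h = gcd(n, k) > 1` then `u`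
is identically zero; if `h = 1` and `k k′ ≡ 1 (mod n)` then `u(t + ζ) = e^{−ik′ζ} u(t)`. -/
theorem central_body_symmetry (n : ℕ) (hn : 2 ≤ n) (k : ℤ) (u : ℝ → ℂ)
    (hper : Function.Periodic u (2 * Real.pi))
    (hsym : ∀ t : ℝ, ∀ l : ℤ,
      u t = Complex.exp (-Complex.I * l * (2 * Real.pi / n)) * u (t - k * l * (2 * Real.pi / n))) :
    (1 < Int.gcd (n : ℤ) k → ∀ t : ℝ, u t = 0) ∧
    (Int.gcd (n : ℤ) k = 1 → ∀ k' : ℤ, k * k' ≡ 1 [ZMOD (n : ℤ)] → ∀ t : ℝ,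
      u (t + 2 * Real.pi / n) = Complex.exp (-Complex.I * k' * (2 * Real.pi / n)) * u t) := by
  have hn0 : (n : ℝ) ≠ 0 := by positivity
  have hnC : (n : ℂ) ≠ 0 := by exact_mod_cast hn0
  have hpi : (Real.pi : ℂ) ≠ 0 := by exact_mod_cast Real.pi_ne_zero
  refine ⟨fun h t => ?_, fun _ k' hk' t => ?_⟩
  · obtain ⟨m, hm⟩ := Int.gcd_dvd_left (n : ℤ) k
    obtain ⟨j, hj⟩ := Int.gcd_dvd_right (n : ℤ) k
    set d : ℕ := Int.gcd (n : ℤ) k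
    have hshift : (k : ℝ) * m * (2 * Real.pi / n) = j * (2 * Real.pi) := by
      have hkm : (k : ℝ) * m = j * n := by
        have : k * m = j * n := by rw [hm, hj]; ring
        exact_mod_cast this
      rw [hkm]
      field_simp
    have ht := hsym t m
    rw [hshift, hper.sub_int_mul_eq] at ht
    by_contra hu
    have hexp : Complex.exp (-Complex.I * m * (2 * Real.pi / n)) = 1 :=
      mul_right_cancel₀ hu (by rw [one_mul]; exact ht.symm)
    obtain ⟨N, hN⟩ := Complex.exp_eq_one_iff.mp hexp
    have hI := Complex.I_ne_zero
    field_simp at hN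
    have hmN : -m = n * N := by
      have : (-m : ℂ) = n * N := by linear_combination hN
      exact_mod_cast this
    have hm0 : m ≠ 0 := by
      rintro rfl
      rw [mul_zero] at hm
      omega
    have hdN : (d : ℤ) * (-N) = 1 :=
      mul_right_cancel₀ hm0 (by linear_combination hmN + N * hm)
    have hd : (d : ℤ) ∣ 1 := ⟨-N, hdN.symm⟩
    have := Int.le_of_dvd one_pos hd
    omega
  · obtain ⟨c, hc⟩ := hk'.symm.dvd
    have hshift : t + 2 * Real.pi / n - k * k' * (2 * Real.pi / n) = t - c * (2 * Real.pi) := by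
      have hkk : (k : ℝ) * k' = 1 + n * c := by
        have : k * k' = 1 + n * c := by linear_combination hc
        exact_mod_cast this
      rw [hkk]
      field_simp
      ring
    rw [hsym (t + 2 * Real.pi / n) k', hshift, hper.sub_int_mul_eq]
end
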